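/- arXiv:1007.1734 — 2 statements merged into one kernel-verified Lean document; each statement's English description precedes it below -/
import Mathlib

section
/- Let t and d be positive integers with t ≤ d+1, let G be a finite connected (d+1)-regular simple graph whose girth is greater than 2t+2, and let α ∈ (0,1) be such that α·d^t is an integer. Then, in the game of Cops and Robbers with robber speed t, the cop number of G is at least α(1−α)·d^{2t} / (2(t+2)(d+1)^t). -/
open SimpleGraph

variable {V : Type*}

/-- The robber, moving with speed `t`, can move from `x` to `y` while the cops occupy
the vertices `cops i`: there is a path of length at most `t` from `x` to `y` that
does not pass through any cop-occupied vertex. -/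
def RobberCanMove {k : ℕ} (G : SimpleGraph V) (t : ℕ) (cops : Fin k → V) (x y : V) : Prop :=
  ∃ w : G.Walk x y, w.IsPath ∧ w.length ≤ t ∧ ∀ i : Fin k, cops i ∉ w.support

/-- A strategy for `k` cops on `G`: an initial placement, and a move function which,
given the current cop positions and the robber's position, tells each cop to stay
where he is or move to an adjacent vertex. -/
structure CopStrategy (G : SimpleGraph V) (k : ℕ) where
  init : Fin k → V
  move : (Fin k → V) → V → (Fin k → V)
  move_valid : ∀ c r i, move c r i = c i ∨ G.Adj (c i) (move c r i)

/-- The sequence of cop positions induced by a cop strategy against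
a robber play `r : ℕ → V` (where `r n` is the robber's position in round `n`). -/
def copSeq {G : SimpleGraph V} {k : ℕ} (CS : CopStrategy G k) (r : ℕ → V) : ℕ → Fin k → V
  | 0 => CS.init
  | n + 1 => CS.move (copSeq CS r n) (r n)

/-- A robber play `r` (with speed `t`) is valid against a cop strategy if, in each round,
the robber either has already been caught or moves along a path of length at most `t`
avoiding the (just moved) cops. -/
def ValidRobberPlay {k : ℕ} (G : SimpleGraph V) (t : ℕ) (CS : CopStrategy G k)
    (r : ℕ → V) : Prop :=
  ∀ n, RobberCanMove G t (copSeq CS r (n + 1)) (r n) (r (n + 1)) ∨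
    ∃ i, copSeq CS r (n + 1) i = r n

/-- A cop strategy is winning (against a speed-`t` robber) if in every valid robber play a cop
eventually steps onto the robber's current vertex (or the robber is caught at the start). -/
def CopsWin {k : ℕ} (G : SimpleGraph V) (t : ℕ) (CS : CopStrategy G k) : Prop :=
  ∀ r : ℕ → V, ValidRobberPlay G t CS r →
    (∃ i, copSeq CS r 0 i = r 0) ∨ ∃ n i, copSeq CS r (n + 1) i = r n

/-- The speed-`t` cop number of `G`: the least number of cops having a winning strategy. -/
noncomputable def copNumber (G : SimpleGraph V) (t : ℕ) : ℕ :=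
  sInf { k | ∃ CS : CopStrategy G k, CopsWin G t CS }

namespace SimpleGraph

variable {G : SimpleGraph V}

/-- Two paths with the same ends whose total length is below the girth coincide. -/
lemma Walk.IsPath.eq_of_length_add_length_lt_girth {u v : V} {p q : G.Walk u v}
    (hp : p.IsPath) (hq : q.IsPath) (h : p.length + q.length < G.girth) : p = q := by
  classical
  let H : SimpleGraph V := fromEdgeSet {e | e ∈ p.edges ++ q.edges}
  have hHG : H ≤ G := by
    intro a b hab
    rcases List.mem_append.1 ((fromEdgeSet_adj _).1 hab).1 with h | h
    · exact p.adj_of_mem_edges h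
    · exact q.adj_of_mem_edges h
  have hsub : ∀ r : G.Walk u v, r.edges ⊆ p.edges ++ q.edges → ∀ e ∈ r.edges, e ∈ H.edgeSet := by
    intro r hr e he
    rw [edgeSet_fromEdgeSet]
    exact ⟨hr he, G.not_isDiag_of_mem_edgeSet (r.edges_subset_edgeSet he)⟩
  have hpH := hsub p (by simp)
  have hqH := hsub q (by simp)
  have hacyc : H.IsAcyclic := by
    intro a c hc
    have hcG : (c.mapLe hHG).IsCycle := hc.mapLe hHG
    have h1 : G.girth ≤ c.length := by simpa using girth_le_length hcG
    have h2 : c.edges ⊆ p.edges ++ q.edges := by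
      intro e he
      have := c.edges_subset_edgeSet he
      rw [edgeSet_fromEdgeSet] at this
      exact this.1
    have h3 := (hc.isTrail.edges_nodup.subperm h2).length_le
    simp only [List.length_append, Walk.length_edges] at h3
    omega
  have := hacyc.subsingleton_path u v
  have key := congrArg Subtype.val (Subsingleton.elim
    (⟨p.transfer H hpH, hp.transfer hpH⟩ : H.Path u v) ⟨q.transfer H hqH, hq.transfer hqH⟩)
  simp only at key
  have hback : ∀ (r : G.Walk u v) (hr : ∀ e ∈ r.edges, e ∈ H.edgeSet),
      (r.transfer H hr).mapLe hHG = r := by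
    intro r hr
    rw [Walk.mapLe, ← Walk.transfer_eq_map_ofLE _ (by
      intro e he
      rw [Walk.edges_transfer] at he
      exact r.edges_subset_edgeSet he), Walk.transfer_transfer, Walk.transfer_self]
  rw [← hback p hpH, ← hback q hqH, key]

/-- A vertex on a shortest walk splits the distance between its ends. -/
lemma Walk.dist_add_dist_of_mem_support (hconn : G.Connected) {u v x : V} {p : G.Walk u v}
    (hp : p.length = G.dist u v) (hx : x ∈ p.support) :
    G.dist u x + G.dist x v = G.dist u v := by
  classical
  have h1 := dist_le (p.takeUntil x hx)
  have h2 := dist_le (p.dropUntil x hx)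
  have h3 := congrArg Walk.length (p.take_spec hx)
  rw [Walk.length_append] at h3
  have := hconn.dist_triangle (u := u) (v := x) (w := v)
  omega

lemma Connected.dist_le_dist_add_one (hconn : G.Connected) (v : V) {x y : V} (h : G.Adj x y) :
    G.dist v x ≤ G.dist v y + 1 := by
  have h1 := hconn.dist_triangle (u := v) (v := y) (w := x)
  rwa [dist_eq_one_iff_adj.2 h.symm] at h1

/-- Every vertex other than `v` has a neighbor closer to `v`. -/
lemma Connected.exists_adj_dist_add_one_eq (hconn : G.Connected) {v x : V} (h : x ≠ v) :
    ∃ y, G.Adj x y ∧ G.dist v y + 1 = G.dist v x := by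
  obtain ⟨p, hp⟩ := hconn.exists_walk_length_eq_dist x v
  cases p with
  | nil => exact absurd rfl h
  | cons hadj q =>
    rename_i y
    refine ⟨y, hadj, ?_⟩
    have h1 := dist_le q
    rw [Walk.length_cons] at hp
    have h2 := hconn.dist_le_dist_add_one v hadj
    rw [dist_comm (u := v) (v := y), dist_comm (u := v) (v := x)] at *
    omega

/-- Below half the girth, the neighbor that is closer to `v` is unique. -/
lemma Connected.eq_of_adj_of_dist_add_one_eq (hconn : G.Connected) {v x y z : V}
    (hy : G.Adj y x) (hz : G.Adj z x) (hvy : G.dist v y + 1 = G.dist v x)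
    (hvz : G.dist v z + 1 = G.dist v x) (hg : 2 * G.dist v x < G.girth) : y = z := by
  obtain ⟨p, hp⟩ := hconn.exists_walk_length_eq_dist v y
  obtain ⟨q, hq⟩ := hconn.exists_walk_length_eq_dist v z
  have hp' : (p.concat hy).length = G.dist v x := by rw [Walk.length_concat]; omega
  have hq' : (q.concat hz).length = G.dist v x := by rw [Walk.length_concat]; omega
  have := ((p.concat hy).isPath_of_length_eq_dist hp').eq_of_length_add_length_lt_girth
    ((q.concat hz).isPath_of_length_eq_dist hq') (by omega)
  simpa using congrArg Walk.penultimate this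

/-- Below half the girth, adjacent vertices have different distances to `v`. -/
lemma Connected.dist_ne_of_adj (hconn : G.Connected) {v x y : V} (hxy : G.Adj x y)
    (hg : 2 * G.dist v x + 1 < G.girth) : G.dist v y ≠ G.dist v x := by
  intro h
  obtain ⟨p, hp⟩ := hconn.exists_walk_length_eq_dist v x
  obtain ⟨q, hq⟩ := hconn.exists_walk_length_eq_dist v y
  have hy : y ∉ p.support := by
    intro hy
    have h1 := p.dist_add_dist_of_mem_support hconn hp hy
    have h2 := dist_eq_one_iff_adj.2 hxy.symm
    omega
  have := ((p.isPath_of_length_eq_dist hp).concat hy hxy).eq_of_length_add_length_lt_girth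
    (q.isPath_of_length_eq_dist hq) (by rw [Walk.length_concat]; omega)
  have := congrArg Walk.length this
  rw [Walk.length_concat] at this
  omega

/-- A shortest walk from `w` to `c` first climbs towards `v`, up to a vertex `m`; if it does not
end there, it continues with a neighbor `q` of `m` which is farther from `v` than `m`. -/
lemma Connected.exists_turn (hconn : G.Connected) {v c : V} (b : ℕ) (hg : 2 * b + 1 < G.girth)
    {w : V} (hw : G.dist v w = b) (hc : G.dist v c + G.dist c w ≠ b) :
    ∃ m q, G.Adj m q ∧ G.dist v m + 1 = G.dist v q ∧ G.dist v m + G.dist m w = b ∧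
      G.dist c w = G.dist c q + 1 + G.dist m w := by
  induction b generalizing w with
  | zero =>
    have hwc : w ≠ c := by rintro rfl; simp [hw] at hc
    obtain ⟨q, hq, hcq⟩ := hconn.exists_adj_dist_add_one_eq hwc
    obtain rfl : v = w := hconn.dist_eq_zero_iff.1 hw
    exact ⟨v, q, hq, by simp [dist_eq_one_iff_adj.2 hq], by simp, by simp [hcq]⟩
  | succ b ih =>
    have hwc : w ≠ c := by rintro rfl; simp [hw] at hc
    obtain ⟨q, hq, hcq⟩ := hconn.exists_adj_dist_add_one_eq hwc
    have h1 := hconn.dist_le_dist_add_one v hq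
    have h2 := hconn.dist_le_dist_add_one v hq.symm
    have h3 := hconn.dist_ne_of_adj (v := v) hq (by omega)
    by_cases h4 : G.dist v q = b + 2
    · exact ⟨w, q, hq, by omega, by simp [hw], by simp [hcq]⟩
    · obtain ⟨m, q', hmq, h5, h6, h7⟩ := ih (by omega) (w := q) (by omega) (by omega)
      have h8 := hconn.dist_triangle (u := v) (v := m) (w := w)
      have h9 := hconn.dist_le_dist_add_one m hq
      exact ⟨m, q', hmq, h5, by omega, by omega⟩

section Count

variable [Fintype V] [DecidableRel G.Adj] {d : ℕ}

/-- In a `(d+1)`-regular graph, a vertex other than `v` has at most `d^s` descendants at depth `s`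
with respect to shortest walks from `v`. -/
lemma IsRegularOfDegree.card_descendants_le (hreg : G.IsRegularOfDegree (d + 1))
    (hconn : G.Connected) {v x : V} (hx : x ≠ v) (s : ℕ) :
    (Finset.univ.filter fun w => G.dist v x + s = G.dist v w ∧ G.dist x w = s).card ≤ d ^ s := by
  classical
  induction s with
  | zero =>
    refine (Finset.card_le_card (t := {x}) ?_).trans (by simp)
    intro w hw
    have := (Finset.mem_filter.1 hw).2.2
    rw [hconn.dist_eq_zero_iff] at this
    simp [this]
  | succ s ih =>
    set S := Finset.univ.filter fun w => G.dist v x + s = G.dist v w ∧ G.dist x w = s with hS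
    refine (Finset.card_le_card
      (t := S.biUnion fun y => (G.neighborFinset y).filter fun w => G.dist v y < G.dist v w)
      ?_).trans ((Finset.card_biUnion_le_card_mul _ _ d ?_).trans ?_)
    · intro w hw
      obtain ⟨h1, h2⟩ := (Finset.mem_filter.1 hw).2
      have hwx : w ≠ x := by rintro rfl; simp at h2
      obtain ⟨y, hy, hxy⟩ := hconn.exists_adj_dist_add_one_eq hwx
      have h3 := hconn.dist_le_dist_add_one v hy
      have h4 := hconn.dist_triangle (u := v) (v := x) (w := y)
      simp only [hS, Finset.mem_biUnion, Finset.mem_filter, Finset.mem_univ, true_and,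
        mem_neighborFinset]
      exact ⟨y, by omega, hy.symm, by omega⟩
    · intro y hy
      have h1 := (Finset.mem_filter.1 hy).2
      have h2 := hconn.pos_dist_of_ne hx.symm
      have hyv : y ≠ v := by rintro rfl; simp only [dist_self] at h1; omega
      obtain ⟨z, hz, hvz⟩ := hconn.exists_adj_dist_add_one_eq hyv
      have h3 : ((G.neighborFinset y).filter fun w => G.dist v y < G.dist v w) ⊂
          G.neighborFinset y := by
        rw [Finset.filter_ssubset]
        exact ⟨z, by simpa using hz, by omega⟩
      have h4 := Finset.card_lt_card h3
      rw [card_neighborFinset_eq_degree, hreg y] at h4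
      omega
    · rw [pow_succ]
      gcongr

/-- A sphere of radius `s+1` in a `(d+1)`-regular graph has at most `(d+1)d^s` vertices. -/
lemma IsRegularOfDegree.card_sphere_le (hreg : G.IsRegularOfDegree (d + 1))
    (hconn : G.Connected) (v : V) (s : ℕ) :
    (Finset.univ.filter fun w => G.dist v w = s + 1).card ≤ (d + 1) * d ^ s := by
  classical
  refine (Finset.card_le_card (t := (G.neighborFinset v).biUnion fun y =>
    Finset.univ.filter fun w => G.dist v y + s = G.dist v w ∧ G.dist y w = s) ?_).trans
      ((Finset.card_biUnion_le_card_mul _ _ (d ^ s) ?_).trans ?_)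
  · intro w hw
    have h1 := (Finset.mem_filter.1 hw).2
    have hvw : v ≠ w := by rintro rfl; simp at h1
    obtain ⟨y, hy, hwy⟩ := hconn.exists_adj_dist_add_one_eq hvw
    have h2 := dist_eq_one_iff_adj.2 hy
    rw [dist_comm (u := w) (v := y), dist_comm (u := w) (v := v)] at hwy
    simp only [Finset.mem_biUnion, Finset.mem_filter, Finset.mem_univ, true_and,
      mem_neighborFinset]
    exact ⟨y, hy, by omega, by omega⟩
  · intro y hy
    exact hreg.card_descendants_le hconn (by simpa using ((G.mem_neighborFinset _ _).1 hy).ne') s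
  · rw [card_neighborFinset_eq_degree, hreg v]

/-- Below half the girth, the spheres of a `(d+1)`-regular graph are as large as in a tree. -/
lemma IsRegularOfDegree.le_card_sphere (hreg : G.IsRegularOfDegree (d + 1))
    (hconn : G.Connected) (v : V) (s : ℕ) (hg : 2 * s + 2 < G.girth) :
    (d + 1) * d ^ s ≤ (Finset.univ.filter fun w => G.dist v w = s + 1).card := by
  classical
  induction s with
  | zero =>
    refine le_of_eq ?_
    rw [pow_zero, mul_one, ← hreg v, ← card_neighborFinset_eq_degree]
    congr 1
    ext w
    simp [dist_eq_one_iff_adj]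
  | succ s ih =>
    have key := Finset.card_mul_le_card_mul (fun x y => G.Adj x y) (m := d) (n := 1)
      (s := Finset.univ.filter fun w => G.dist v w = s + 1)
      (t := Finset.univ.filter fun w => G.dist v w = s + 1 + 1) ?_ ?_
    · calc (d + 1) * d ^ (s + 1) = ((d + 1) * d ^ s) * d := by ring
        _ ≤ (Finset.univ.filter fun w => G.dist v w = s + 1).card * d := by
          gcongr; exact ih (by omega)
        _ ≤ _ := by simpa using key
    · intro x hx
      have hx' := (Finset.mem_filter.1 hx).2
      have hxv : x ≠ v := by rintro rfl; simp at hx'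
      obtain ⟨z, hz, hvz⟩ := hconn.exists_adj_dist_add_one_eq hxv
      have : (G.neighborFinset x).erase z ⊆ Finset.bipartiteAbove (fun x y => G.Adj x y)
          (Finset.univ.filter fun w => G.dist v w = s + 1 + 1) x := by
        intro y hy
        obtain ⟨hyz, hy⟩ := Finset.mem_erase.1 hy
        have hxy := (G.mem_neighborFinset _ _).1 hy
        have h1 := hconn.dist_le_dist_add_one v hxy
        have h2 := hconn.dist_le_dist_add_one v hxy.symm
        have h3 := hconn.dist_ne_of_adj (v := v) hxy (by omega)
        have h4 : G.dist v y + 1 ≠ G.dist v x := fun h4 =>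
          hyz (hconn.eq_of_adj_of_dist_add_one_eq hxy.symm hz.symm h4 hvz (by omega))
        simp only [Finset.bipartiteAbove, Finset.mem_filter, Finset.mem_univ, true_and]
        exact ⟨by omega, hxy⟩
      refine le_trans ?_ (Finset.card_le_card this)
      rw [Finset.card_erase_of_mem (by simpa using hz), card_neighborFinset_eq_degree, hreg x]
      simp
    · intro x hx
      have hx' := (Finset.mem_filter.1 hx).2
      rw [Finset.card_le_one]
      intro y hy z hz
      simp only [Finset.bipartiteBelow, Finset.mem_filter, Finset.mem_univ, true_and] at hy hz
      exact hconn.eq_of_adj_of_dist_add_one_eq (v := v) hy.2 hz.2 (by omega) (by omega) (by omega)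

end Count
end SimpleGraph

lemma Finset.sum_biUnion_le_sum_sum {ι κ : Type*} [DecidableEq ι] [DecidableEq κ]
    (s : Finset ι) (T : ι → Finset κ) (f : κ → ℕ) :
    ∑ w ∈ s.biUnion T, f w ≤ ∑ q ∈ s, ∑ w ∈ T q, f w := by
  induction s using Finset.induction_on with
  | empty => simp
  | insert a s ha ih =>
    rw [Finset.biUnion_insert, Finset.sum_insert ha]
    have := Finset.sum_union_inter (s₁ := T a) (s₂ := s.biUnion T) (f := f)
    omega

namespace SimpleGraph

variable {G : SimpleGraph V}

/-- The number of vertices at distance `t` from `v` that a cop at `c` can cut off from `v` in one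
step, in a `(d+1)`-regular graph of girth greater than `2t+2`. -/
noncomputable def threat (G : SimpleGraph V) (t d : ℕ) (c v : V) : ℕ :=
  if G.dist c v ≤ t + 1 then d ^ (t + 1 - G.dist c v) else 0

section Threat

variable [Fintype V]

/-- Summing a function of the distance to `c` over a ball, sphere by sphere. -/
lemma sum_ball_dist_le (c : V) (N B : ℕ) (β : ℕ → ℕ)
    (h : ∀ l ≤ N, (Finset.univ.filter fun x => G.dist c x = l).card * β l ≤ B) :
    ∑ x ∈ Finset.univ.filter (fun x => G.dist c x ≤ N), β (G.dist c x) ≤ (N + 1) * B := by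
  classical
  rw [← Finset.sum_fiberwise_of_maps_to (g := fun x => G.dist c x) (t := Finset.range (N + 1))
    (by intro x hx; have := (Finset.mem_filter.1 hx).2; simp; omega)]
  refine (Finset.sum_le_card_nsmul _ _ B ?_).trans (by simp)
  intro l hl
  refine le_trans ?_ (h l (by simpa [Nat.lt_succ_iff] using hl))
  rw [← smul_eq_mul]
  refine (Finset.sum_le_card_nsmul _ _ (β l) ?_).trans ?_
  · intro x hx
    rw [(Finset.mem_filter.1 hx).2]
  · gcongr
    intro x hx
    simp

lemma Connected.card_sphere_zero (hconn : G.Connected) (c : V) :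
    (Finset.univ.filter fun x => G.dist c x = 0).card = 1 := by
  rw [Finset.card_eq_one]
  refine ⟨c, ?_⟩
  ext x
  rw [Finset.mem_filter, hconn.dist_eq_zero_iff]
  simp [eq_comm]

variable [DecidableRel G.Adj] {d : ℕ}

lemma IsRegularOfDegree.card_sphere_mul_pow_le (hreg : G.IsRegularOfDegree (d + 1))
    (hconn : G.Connected) (c : V) (n l : ℕ) (hl : l ≤ n + 1) :
    (Finset.univ.filter fun x => G.dist c x = l).card * d ^ (n + 1 - l) ≤ (d + 1) * d ^ n := by
  classical
  cases l with
  | zero =>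
    rw [hconn.card_sphere_zero c, one_mul, Nat.sub_zero, pow_succ']
    gcongr
    omega
  | succ s =>
    calc _ ≤ ((d + 1) * d ^ s) * d ^ (n + 1 - (s + 1)) := by
          gcongr
          exact hreg.card_sphere_le hconn c s
      _ = (d + 1) * d ^ n := by
          rw [mul_assoc, ← pow_add]
          congr 2
          omega

/-- The total threat of one cop. -/
lemma IsRegularOfDegree.sum_threat_le (hreg : G.IsRegularOfDegree (d + 1))
    (hconn : G.Connected) (t : ℕ) (c : V) :
    ∑ v, G.threat t d c v ≤ (t + 2) * ((d + 1) * d ^ t) := by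
  simp only [threat]
  rw [← Finset.sum_filter]
  exact sum_ball_dist_le c (t + 1) _ (fun l => d ^ (t + 1 - l))
    fun l hl => hreg.card_sphere_mul_pow_le hconn c t l hl

/-- The total threat of one cop at `c` to those vertices at distance `n+1` from `v` whose shortest
walk from `v` avoids `c`. -/
lemma IsRegularOfDegree.sum_threat_sphere_le (hreg : G.IsRegularOfDegree (d + 1))
    (hconn : G.Connected) (n : ℕ) (hg : 2 * n + 4 < G.girth) (v c : V) :
    ∑ w ∈ Finset.univ.filter
      (fun w => G.dist v w = n + 1 ∧ G.dist v c + G.dist c w ≠ n + 1),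
      G.threat (n + 1) d c w ≤ (n + 2) * ((d + 1) * d ^ n) := by
  classical
  let T : V → Finset V := fun q => Finset.univ.filter fun w =>
    G.dist c w ≤ n + 2 ∧ ∃ m, G.Adj m q ∧ G.dist v m + 1 = G.dist v q ∧ G.dist v w = n + 1 ∧
      G.dist v m + G.dist m w = n + 1 ∧ G.dist c w = G.dist c q + 1 + G.dist m w
  let β : ℕ → ℕ := fun l => if l = 0 then (d + 1) * d ^ n else d ^ (n + 1 - l)
  have hT : ∀ q, ∑ w ∈ T q, G.threat (n + 1) d c w ≤ β (G.dist c q) := by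
    intro q
    obtain hemp | ⟨w₀, hw₀⟩ := (T q).eq_empty_or_nonempty
    · simp [hemp]
    obtain ⟨h1, m, hmq, h2, -, h3, h4⟩ := (Finset.mem_filter.1 hw₀).2
    have hmem : ∀ w ∈ T q, G.dist v w = n + 1 ∧ G.dist v m + G.dist m w = n + 1 ∧
        G.dist c w = G.dist c q + 1 + G.dist m w := by
      intro w hw
      obtain ⟨-, m', hmq', h2', h5', h3', h4'⟩ := (Finset.mem_filter.1 hw).2
      obtain rfl := hconn.eq_of_adj_of_dist_add_one_eq hmq hmq' h2 h2' (by omega)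
      exact ⟨h5', h3', h4'⟩
    have hsum : ∑ w ∈ T q, G.threat (n + 1) d c w
        ≤ (T q).card * d ^ (G.dist v m - G.dist c q) := by
      rw [← smul_eq_mul]
      refine Finset.sum_le_card_nsmul _ _ _ fun w hw => le_of_eq ?_
      obtain ⟨h5, h6, h7⟩ := hmem w hw
      rw [threat, if_pos (by omega)]
      congr 1
      omega
    refine hsum.trans ?_
    by_cases hmv : m = v
    · subst hmv
      have hcq : G.dist c q = 0 := by
        rw [dist_self] at h3
        omega
      simp only [dist_self, hcq, β, if_true, Nat.sub_zero, pow_zero, mul_one]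
      refine le_trans (Finset.card_le_card ?_) (hreg.card_sphere_le hconn m n)
      intro w hw
      simpa using (hmem w hw).1
    · have hcard : (T q).card ≤ d ^ (n + 1 - G.dist v m) := by
        refine le_trans (Finset.card_le_card ?_) (hreg.card_descendants_le hconn hmv _)
        intro w hw
        obtain ⟨h5, h6, -⟩ := hmem w hw
        simp only [Finset.mem_filter, Finset.mem_univ, true_and]
        omega
      calc _ ≤ d ^ (n + 1 - G.dist v m) * d ^ (G.dist v m - G.dist c q) := by gcongr
        _ = d ^ (n + 1 - G.dist c q) := by
          rw [← pow_add]
          congr 1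
          omega
        _ ≤ β (G.dist c q) := by
          by_cases hl : G.dist c q = 0
          · simp only [hl, β, if_true, Nat.sub_zero, pow_succ']
            gcongr
            omega
          · simp [β, hl]
  have hcover : (Finset.univ.filter
      (fun w => G.dist v w = n + 1 ∧ G.dist v c + G.dist c w ≠ n + 1)).filter
        (fun w => G.dist c w ≤ n + 2) ⊆
      (Finset.univ.filter fun q => G.dist c q ≤ n + 1).biUnion T := by
    intro w hw
    simp only [Finset.mem_filter, Finset.mem_univ, true_and] at hw
    obtain ⟨⟨h1, h2⟩, h3⟩ := hw
    obtain ⟨m, q, hmq, h4, h5, h6⟩ := hconn.exists_turn (n + 1) (by omega) h1 h2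
    simp only [Finset.mem_biUnion, Finset.mem_filter, Finset.mem_univ, true_and, T]
    exact ⟨q, by omega, h3, m, hmq, h4, h1, h5, h6⟩
  calc _ = ∑ w ∈ (Finset.univ.filter
        (fun w => G.dist v w = n + 1 ∧ G.dist v c + G.dist c w ≠ n + 1)).filter
          (fun w => G.dist c w ≤ n + 2), G.threat (n + 1) d c w := by
        refine (Finset.sum_filter_of_ne ?_).symm
        intro w _ hw
        by_contra h
        exact hw (if_neg h)
    _ ≤ ∑ w ∈ (Finset.univ.filter fun q => G.dist c q ≤ n + 1).biUnion T,
          G.threat (n + 1) d c w := Finset.sum_le_sum_of_subset hcover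
    _ ≤ ∑ q ∈ Finset.univ.filter (fun q => G.dist c q ≤ n + 1),
          ∑ w ∈ T q, G.threat (n + 1) d c w := Finset.sum_biUnion_le_sum_sum _ _ _
    _ ≤ ∑ q ∈ Finset.univ.filter (fun q => G.dist c q ≤ n + 1), β (G.dist c q) :=
        Finset.sum_le_sum fun q _ => hT q
    _ ≤ (n + 2) * ((d + 1) * d ^ n) := by
        refine sum_ball_dist_le c (n + 1) _ β fun l hl => ?_
        by_cases h0 : l = 0
        · subst h0
          rw [hconn.card_sphere_zero c, one_mul]
          simp [β]
        · simp only [β, if_neg h0]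
          exact hreg.card_sphere_mul_pow_le hconn c n l hl

/-- A cop who has just moved from `c` to `c'`, without reaching `v`, cuts off at most
`threat c v` vertices at distance `t` from `v`. -/
lemma IsRegularOfDegree.card_cut_off_le_threat (hreg : G.IsRegularOfDegree (d + 1))
    (hconn : G.Connected) (hd : 0 < d) (t : ℕ) {v c c' : V} (hcc : c' = c ∨ G.Adj c c')
    (hv : c' ≠ v) :
    (Finset.univ.filter fun w => G.dist v w = t ∧ G.dist v c' + G.dist c' w = t).card
      ≤ G.threat t d c v := by
  obtain hemp | ⟨w₀, hw₀⟩ := (Finset.univ.filter fun w =>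
    G.dist v w = t ∧ G.dist v c' + G.dist c' w = t).eq_empty_or_nonempty
  · simp [hemp]
  have h0 := (Finset.mem_filter.1 hw₀).2
  have h1 : G.dist v c ≤ G.dist v c' + 1 := by
    rcases hcc with rfl | h
    · omega
    · exact hconn.dist_le_dist_add_one v h
  rw [threat, dist_comm (u := c), if_pos (by omega)]
  calc _ ≤ d ^ (t - G.dist v c') := by
        refine le_trans (Finset.card_le_card ?_) (hreg.card_descendants_le hconn hv _)
        intro w hw
        simp only [Finset.mem_filter, Finset.mem_univ, true_and] at hw ⊢
        omega
    _ ≤ _ := Nat.pow_le_pow_right hd (by omega)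

end Threat
end SimpleGraph

section Robber

variable [Fintype V] {G : SimpleGraph V} [DecidableRel G.Adj] {d k : ℕ}

/-- There is a vertex at which the total threat of the cops is below average. -/
lemma exists_sum_threat_lt (hconn : G.Connected) (hreg : G.IsRegularOfDegree (d + 1)) (t : ℕ)
    (cops : Fin k → V) (M : ℝ) (hM : (k : ℝ) * ((t + 2) * ((d + 1) * d ^ t)) < M * Fintype.card V) :
    ∃ v, ((∑ i, G.threat t d (cops i) v : ℕ) : ℝ) < M := by
  by_contra! h
  have h1 : ∑ v, ∑ i, G.threat t d (cops i) v ≤ k * ((t + 2) * ((d + 1) * d ^ t)) := by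
    rw [Finset.sum_comm]
    refine (Finset.sum_le_card_nsmul _ _ _ fun i _ => hreg.sum_threat_le hconn t (cops i)).trans ?_
    simp
  have h2 : M * Fintype.card V ≤ ∑ v : V, ((∑ i, G.threat t d (cops i) v : ℕ) : ℝ) := by
    have := Finset.card_nsmul_le_sum Finset.univ
      (fun v : V => ((∑ i, G.threat t d (cops i) v : ℕ) : ℝ)) M fun v _ => h v
    rwa [nsmul_eq_mul, mul_comm, Finset.card_univ] at this
  have h3 : ((∑ v, ∑ i, G.threat t d (cops i) v : ℕ) : ℝ) ≤
      (k * ((t + 2) * ((d + 1) * d ^ t)) : ℕ) := by exact_mod_cast h1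
  push_cast at h2 h3
  linarith

/-- If the total threat at the robber's vertex is small, then no cop can catch her in one step, and
she can move to another vertex at which the total threat is small. -/
lemma exists_robberCanMove_sum_threat_lt (hconn : G.Connected)
    (hreg : G.IsRegularOfDegree (d + 1)) (hd : 0 < d) (n : ℕ) (hg : 2 * n + 4 < G.girth)
    {α : ℝ} (hα0 : 0 < α) (hα1 : α < 1)
    (hk : (k : ℝ) * ((n + 2) * ((d + 1) * d ^ n)) ≤ α * (1 - α) * (d ^ (n + 1) * d ^ (n + 1)))
    {cops cops' : Fin k → V} {v : V}
    (hv : ((∑ i, G.threat (n + 1) d (cops i) v : ℕ) : ℝ) < (1 - α) * d ^ (n + 1))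
    (hmove : ∀ i, cops' i = cops i ∨ G.Adj (cops i) (cops' i)) :
    (∀ i, cops' i ≠ v) ∧ ∃ w, RobberCanMove G (n + 1) cops' v w ∧
      ((∑ i, G.threat (n + 1) d (cops' i) w : ℕ) : ℝ) < (1 - α) * d ^ (n + 1) := by
  classical
  have hdpos : (0 : ℝ) < (d : ℝ) ^ (n + 1) := by positivity
  have hfree : ∀ i, cops' i ≠ v := by
    intro i hi
    have h1 : G.dist (cops i) v ≤ 1 := by
      rcases hmove i with h | h
      · simp [← h, hi]
      · rw [hi] at h
        exact (dist_eq_one_iff_adj.2 h).le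
    have h2 : d ^ (n + 1) ≤ G.threat (n + 1) d (cops i) v := by
      rw [threat, if_pos (by omega)]
      exact Nat.pow_le_pow_right hd (by omega)
    have h3 : d ^ (n + 1) ≤ ∑ i, G.threat (n + 1) d (cops i) v :=
      h2.trans (Finset.single_le_sum (f := fun i => G.threat (n + 1) d (cops i) v)
        (fun _ _ => Nat.zero_le _) (Finset.mem_univ i))
    have h4 : (d : ℝ) ^ (n + 1) ≤ ((∑ i, G.threat (n + 1) d (cops i) v : ℕ) : ℝ) := by
      exact_mod_cast h3
    nlinarith
  refine ⟨hfree, ?_⟩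
  set U := Finset.univ.filter fun w => G.dist v w = n + 1 ∧
    ∀ i, G.dist v (cops' i) + G.dist (cops' i) w ≠ n + 1 with hU
  have hUcard : α * d ^ (n + 1) < U.card := by
    have h1 : (Finset.univ.filter fun w => G.dist v w = n + 1) ⊆
        U ∪ Finset.univ.biUnion fun i => Finset.univ.filter fun w =>
          G.dist v w = n + 1 ∧ G.dist v (cops' i) + G.dist (cops' i) w = n + 1 := by
      intro w hw
      have hw' := (Finset.mem_filter.1 hw).2
      by_cases h : ∃ i, G.dist v (cops' i) + G.dist (cops' i) w = n + 1
      · obtain ⟨i, hi⟩ := h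
        refine Finset.mem_union_right _ (Finset.mem_biUnion.2 ⟨i, Finset.mem_univ _, ?_⟩)
        simp [hw', hi]
      · push Not at h
        exact Finset.mem_union_left _ (by simp [hU, hw', h])
    have h2 : d ^ (n + 1) ≤ U.card + ∑ i, G.threat (n + 1) d (cops i) v :=
      calc d ^ (n + 1) ≤ (d + 1) * d ^ n := by rw [pow_succ']; gcongr; omega
        _ ≤ _ := hreg.le_card_sphere hconn v n (by omega)
        _ ≤ _ := Finset.card_le_card h1
        _ ≤ _ := Finset.card_union_le _ _
        _ ≤ _ := by
          gcongr
          refine Finset.card_biUnion_le.trans (Finset.sum_le_sum fun i _ => ?_)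
          exact hreg.card_cut_off_le_threat hconn hd (n + 1) (hmove i) (hfree i)
    have h3 : (d : ℝ) ^ (n + 1) ≤
        U.card + ((∑ i, G.threat (n + 1) d (cops i) v : ℕ) : ℝ) := by exact_mod_cast h2
    linarith
  have hsum : ∑ w ∈ U, ∑ i, G.threat (n + 1) d (cops' i) w ≤
      k * ((n + 2) * ((d + 1) * d ^ n)) := by
    rw [Finset.sum_comm]
    refine (Finset.sum_le_card_nsmul _ _ ((n + 2) * ((d + 1) * d ^ n)) fun i _ => ?_).trans
      (by simp)
    refine le_trans (Finset.sum_le_sum_of_subset ?_)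
      (hreg.sum_threat_sphere_le hconn n hg v (cops' i))
    intro w hw
    have := (Finset.mem_filter.1 hw).2
    simp [this.1, this.2 i]
  obtain ⟨w, hwU, hw⟩ : ∃ w ∈ U,
      ((∑ i, G.threat (n + 1) d (cops' i) w : ℕ) : ℝ) < (1 - α) * d ^ (n + 1) := by
    by_contra! h
    have h1 := Finset.card_nsmul_le_sum U
      (fun w => ((∑ i, G.threat (n + 1) d (cops' i) w : ℕ) : ℝ)) _ h
    have h2 : ((∑ w ∈ U, ∑ i, G.threat (n + 1) d (cops' i) w : ℕ) : ℝ) ≤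
      (k * ((n + 2) * ((d + 1) * d ^ n)) : ℕ) := by exact_mod_cast hsum
    have h3 : α * d ^ (n + 1) * ((1 - α) * d ^ (n + 1)) < U.card * ((1 - α) * d ^ (n + 1)) := by
      have : 0 < 1 - α := by linarith
      gcongr
    rw [nsmul_eq_mul] at h1
    push_cast at h1 h2
    linarith
  refine ⟨w, ?_, hw⟩
  obtain ⟨hvw, havoid⟩ := (Finset.mem_filter.1 hwU).2
  obtain ⟨p, hp⟩ := hconn.exists_walk_length_eq_dist v w
  refine ⟨p, p.isPath_of_length_eq_dist hp, by omega, fun i hi => havoid i ?_⟩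
  rw [p.dist_add_dist_of_mem_support hconn hp hi, hvw]

end Robber

/-- If from every position satisfying the invariant `P` the robber can survive the next move of the
cops and restore `P`, then the cops' strategy is not winning. -/
lemma not_copsWin_of_invariant {G : SimpleGraph V} {t k : ℕ} (CS : CopStrategy G k)
    (P : (Fin k → V) → V → Prop) (hinit : ∃ v, P CS.init v)
    (hstep : ∀ c c' v, P c v → (∀ i, c' i = c i ∨ G.Adj (c i) (c' i)) →
      (∀ i, c' i ≠ v) ∧ ∃ w, RobberCanMove G t c' v w ∧ P c' w) : ¬ CopsWin G t CS := by
  obtain ⟨v₀, hv₀⟩ := hinit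
  have hreply : ∀ s : {s : (Fin k → V) × V // P s.1 s.2}, ∃ w,
      RobberCanMove G t (CS.move s.1.1 s.1.2) s.1.2 w ∧ P (CS.move s.1.1 s.1.2) w :=
    fun s => (hstep _ _ _ s.2 (CS.move_valid _ _)).2
  choose reply hmove hP using hreply
  let state : ℕ → {s : (Fin k → V) × V // P s.1 s.2} := fun n => Nat.rec ⟨(CS.init, v₀), hv₀⟩
    (fun _ s => ⟨(CS.move s.1.1 s.1.2, reply s), hP s⟩) n
  let r : ℕ → V := fun n => (state n).1.2
  have hcops : ∀ n, copSeq CS r n = (state n).1.1 := by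
    intro n
    induction n with
    | zero => rfl
    | succ n ih =>
      change CS.move (copSeq CS r n) (r n) = _
      rw [ih]
  intro hwin
  have hvalid : ValidRobberPlay G t CS r := by
    intro n
    rw [hcops (n + 1)]
    exact Or.inl (hmove (state n))
  rcases hwin r hvalid with ⟨i, hi⟩ | ⟨n, i, hi⟩
  · exact (hstep _ CS.init v₀ hv₀ fun _ => Or.inl rfl).1 i hi
  · rw [hcops (n + 1)] at hi
    exact (hstep _ _ _ (state n).2 (CS.move_valid _ _)).1 i hi

/-- With one cop on every vertex the cops win at once. -/
lemma exists_copsWin [Fintype V] (G : SimpleGraph V) (t : ℕ) :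
    ∃ k, ∃ CS : CopStrategy G k, CopsWin G t CS := by
  refine ⟨Fintype.card V, ⟨(Fintype.equivFin V).symm, fun c _ => c, fun _ _ _ => Or.inl rfl⟩, ?_⟩
  intro r _
  exact Or.inl ⟨Fintype.equivFin V (r 0), by simp [copSeq]⟩

/-- If `t ≤ d + 1`, `G` is a finite connected `(d+1)`-regular graph with
girth greater than `2t+2`, and `α ∈ (0,1)` with `α·d^t` an integer, then the speed-`t` cop
number of `G` is at least `α(1-α)d^(2t) / (2(t+2)(d+1)^t)`. -/
theorem stmt0 {V : Type*} [Fintype V] (t d : ℕ) (ht : 0 < t) (hd : 0 < d)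
    (htd : t ≤ d + 1) (G : SimpleGraph V) [DecidableRel G.Adj]
    (hconn : G.Connected) (hreg : G.IsRegularOfDegree (d + 1))
    (hgirth : (2 * t + 2 : ℕ∞) < G.girth)
    (α : ℝ) (hα0 : 0 < α) (hα1 : α < 1) (hint : ∃ m : ℤ, α * (d : ℝ) ^ t = m) :
    α * (1 - α) * (d : ℝ) ^ (2 * t) / (2 * (t + 2) * ((d : ℝ) + 1) ^ t)
      ≤ (copNumber G t : ℝ) := by
  obtain ⟨n, rfl⟩ : ∃ n, t = n + 1 := ⟨t - 1, by omega⟩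
  have hg : 2 * n + 4 < G.girth := by
    have : 2 * (n + 1) + 2 < G.girth := by exact_mod_cast hgirth
    omega
  obtain ⟨CS, hCS⟩ : ∃ CS : CopStrategy G (copNumber G (n + 1)), CopsWin G (n + 1) CS :=
    Nat.sInf_mem (exists_copsWin G (n + 1))
  by_contra! hlt
  generalize copNumber G (n + 1) = k at CS hCS hlt
  have hd1 : (1 : ℝ) ≤ d := by exact_mod_cast hd
  have h1α : 0 < 1 - α := by linarith
  rw [lt_div_iff₀ (by positivity)] at hlt
  push_cast at hlt
  have hpow : ∀ m : ℕ, (d : ℝ) ^ m ≤ (d + 1 : ℝ) ^ m := fun m => by gcongr; linarith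
  have hsq : (d : ℝ) ^ (2 * (n + 1)) = d ^ (n + 1) * d ^ (n + 1) := by ring
  rw [hsq] at hlt
  refine not_copsWin_of_invariant CS
    (fun c v => ((∑ i, G.threat (n + 1) d (c i) v : ℕ) : ℝ) < (1 - α) * d ^ (n + 1))
    (exists_sum_threat_lt hconn hreg (n + 1) CS.init _ ?_)
    (fun c c' v hv hm => exists_robberCanMove_sum_threat_lt hconn hreg hd n hg hα0 hα1 ?_ hv hm) hCS
  · obtain ⟨v⟩ := hconn.nonempty
    have hcard : ((d : ℝ) + 1) * d ^ (n + 1) ≤ Fintype.card V := by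
      have := (hreg.le_card_sphere hconn v (n + 1) (by omega)).trans (Finset.card_le_univ _)
      exact_mod_cast this
    have h1 : ((k : ℝ) * (n + 3)) * d ^ (n + 1) < ((1 - α) * d ^ (n + 1)) * d ^ (n + 1) := by
      calc ((k : ℝ) * (n + 3)) * d ^ (n + 1)
          ≤ ((k : ℝ) * (n + 3)) * (d + 1) ^ (n + 1) := by gcongr; linarith
        _ ≤ 2 * (((k : ℝ) * (n + 3)) * (d + 1) ^ (n + 1)) := by
          have : 0 ≤ ((k : ℝ) * (n + 3)) * (d + 1) ^ (n + 1) := by positivity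
          linarith
        _ = k * (2 * (n + 1 + 2) * (d + 1) ^ (n + 1)) := by ring
        _ < α * (1 - α) * (d ^ (n + 1) * d ^ (n + 1)) := hlt
        _ ≤ 1 * (1 - α) * (d ^ (n + 1) * d ^ (n + 1)) := by gcongr
        _ = _ := by ring
    have h2 := lt_of_mul_lt_mul_right h1 (by positivity)
    calc (k : ℝ) * (((n + 1 : ℕ) + 2) * ((d + 1) * d ^ (n + 1)))
        = (k * (n + 3)) * ((d + 1) * d ^ (n + 1)) := by push_cast; ring
      _ < ((1 - α) * d ^ (n + 1)) * ((d + 1) * d ^ (n + 1)) := by gcongr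
      _ ≤ _ := by gcongr
  · calc (k : ℝ) * ((n + 2) * ((d + 1) * d ^ n))
        ≤ k * ((2 * (n + 1 + 2)) * ((d + 1) * (d + 1) ^ n)) := by
          gcongr
          · linarith
          · linarith
      _ = k * (2 * (n + 1 + 2) * (d + 1) ^ (n + 1)) := by ring
      _ ≤ _ := hlt.le
end

section
/- For every vertex w of G that does not lie in U, the number of escaping paths that contain at least one vertex of the closed neighborhood of w (that is, w itself or a neighbor of w) is at most (t+2)(d+1)^t. -/
open SimpleGraph

variable {V : Type*}

/-- The set `U` of all vertices lying on some path of length `t` from `r` to a vertex of `S`. -/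
def pathUnion (G : SimpleGraph V) (t : ℕ) (r : V) (S : Set V) : Set V :=
  {v | ∃ s ∈ S, ∃ w : G.Walk r s, w.IsPath ∧ w.length = t ∧ v ∈ w.support}

/-- An *escaping path* (encoded by its two endpoints together with the walk joining them)
is a path of length `t` whose first vertex lies in `S` and whose second vertex lies
outside `U`. -/
def IsEscapingPath (G : SimpleGraph V) (t : ℕ) (S U : Set V)
    (p : Σ u : V, Σ v : V, G.Walk u v) : Prop :=
  p.2.2.IsPath ∧ p.2.2.length = t ∧ p.1 ∈ S ∧ p.2.2.getVert 1 ∉ U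

/-- Two paths with the same endpoints coincide when their total length is below the girth. -/
theorem eq_of_isPath_of_length_add_length_lt_girth {G : SimpleGraph V} {u v : V}
    {p q : G.Walk u v} (hp : p.IsPath) (hq : q.IsPath)
    (h : p.length + q.length < G.girth) : p = q := by
  let H : SimpleGraph V := SimpleGraph.fromEdgeSet {e | e ∈ p.edges ++ q.edges}
  have mem_edgeSet : ∀ e ∈ p.edges ++ q.edges, e ∈ H.edgeSet := by
    intro e he
    have heG : e ∈ G.edgeSet := by
      rcases List.mem_append.1 he with he | he
      · exact p.edges_subset_edgeSet he
      · exact q.edges_subset_edgeSet he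
    simp only [H, SimpleGraph.edgeSet_fromEdgeSet]
    exact ⟨he, G.not_isDiag_of_mem_edgeSet heG⟩
  have mem_of_mem_edgeSet : ∀ e ∈ H.edgeSet, e ∈ p.edges ++ q.edges := by
    intro e he
    simp only [H, SimpleGraph.edgeSet_fromEdgeSet] at he
    exact he.1
  have hle : H ≤ G := by
    rw [← SimpleGraph.edgeSet_subset_edgeSet]
    intro e he
    rcases List.mem_append.1 (mem_of_mem_edgeSet e he) with he | he
    · exact p.edges_subset_edgeSet he
    · exact q.edges_subset_edgeSet he
  have hacyc : H.IsAcyclic := by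
    intro a c hc
    have hlen : c.edges.length ≤ (p.edges ++ q.edges).length :=
      (hc.edges_nodup.subperm fun e he =>
        mem_of_mem_edgeSet e (c.edges_subset_edgeSet he)).length_le
    have hgirth := SimpleGraph.girth_le_length (hc.mapLe hle)
    simp only [Walk.length_edges, List.length_append, Walk.length_map] at hlen hgirth
    omega
  have hpH : ∀ e ∈ p.edges, e ∈ H.edgeSet := fun e he =>
    mem_edgeSet e (List.mem_append_left _ he)
  have hqH : ∀ e ∈ q.edges, e ∈ H.edgeSet := fun e he =>
    mem_edgeSet e (List.mem_append_right _ he)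
  have heq := congrArg Subtype.val
    ((hacyc.subsingleton_path u v).elim ⟨p.transfer H hpH, hp.transfer hpH⟩
      ⟨q.transfer H hqH, hq.transfer hqH⟩)
  refine Walk.ext_support ?_
  simpa using congrArg Walk.support heq

/-- A vertex outside `U` has at most one neighbor in `S`. -/
theorem eq_of_adj_of_notMem_pathUnion {G : SimpleGraph V} {t : ℕ} (ht : 0 < t)
    (hgirth : 2 * t + 2 < G.girth) {r : V} {S : Set V} (hS : ∀ s ∈ S, G.dist r s = t)
    {v : V} (hv : v ∉ pathUnion G t r S) {a b : V} (ha : a ∈ S) (hb : b ∈ S)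
    (hav : G.Adj a v) (hbv : G.Adj b v) : a = b := by
  have exists_path : ∀ s ∈ S, ∃ p : G.Walk r s, p.IsPath ∧ p.length = t ∧ v ∉ p.support := by
    intro s hs
    have hne : G.dist r s ≠ 0 := by rw [hS s hs]; omega
    obtain ⟨p, hp, hpl⟩ := (Reachable.of_dist_ne_zero hne).exists_path_of_dist
    rw [hS s hs] at hpl
    exact ⟨p, hp, hpl, fun hvp => hv ⟨s, hs, p, hp, hpl, hvp⟩⟩
  obtain ⟨p, hp, hpl, hpv⟩ := exists_path a ha
  obtain ⟨q, hq, hql, hqv⟩ := exists_path b hb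
  have heq := eq_of_isPath_of_length_add_length_lt_girth (hp.concat hpv hav) (hq.concat hqv hbv)
    (by simp only [Walk.length_concat]; omega)
  exact (Walk.concat_inj heq).1

/-- In a regular graph of degree `n`, the neighbors of each vertex can be labelled
injectively by `Fin n`. -/
theorem exists_neighbor_labelling [Fintype V] {G : SimpleGraph V} [DecidableRel G.Adj] {n : ℕ}
    (hn : 0 < n) (hreg : G.IsRegularOfDegree n) :
    ∃ e : V → V → Fin n, ∀ v a b, G.Adj v a → G.Adj v b → e v a = e v b → a = b := by
  classical
  have hcard : ∀ v, Fintype.card (G.neighborSet v) = n := fun v => by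
    rw [card_neighborSet_eq_degree, hreg v]
  refine ⟨fun v a => if h : G.Adj v a then Fintype.equivFinOfCardEq (hcard v) ⟨a, h⟩ else ⟨0, hn⟩,
    fun v a b ha hb hab => ?_⟩
  simp only [ha, hb, dif_pos] at hab
  exact congrArg Subtype.val ((Fintype.equivFinOfCardEq (hcard v)).injective hab)

/-- A walk that meets the closed neighborhood of `w` and does not start at `w` contains a
neighbor of `w`. -/
theorem exists_adj_getVert {G : SimpleGraph V} {u v w : V} {p : G.Walk u v} (hu : u ≠ w)
    (h : ∃ x ∈ p.support, x = w ∨ G.Adj w x) : ∃ i ≤ p.length, G.Adj w (p.getVert i) := by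
  obtain ⟨x, hx, hxw⟩ := h
  obtain ⟨i, rfl, hi⟩ := Walk.mem_support_iff_exists_getVert.1 hx
  rcases hxw with hxw | hxw
  · obtain _ | i := i
    · exact absurd (by simpa using hxw) hu
    · exact ⟨i, by omega, hxw ▸ (p.adj_getVert_succ (by omega)).symm⟩
  · exact ⟨i, hi, hxw⟩

/-- The code of a vertex sequence `f` whose `i`-th term is a neighbor of `w`: the labels met when
walking from `w` to `f i`, from there back to `f 1`, and from `f i` on to `f t`. -/
def pathCode {n : ℕ} (e : V → V → Fin n) (w : V) (t i : ℕ) (f : ℕ → V) (j : Fin t) : Fin n :=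
  if (j : ℕ) < i then
    if (j : ℕ) = 0 then e w (f i) else e (f (j + 1)) (f j)
  else e (f j) (f (j + 1))

/-- A vertex sequence can be recovered from its code as soon as its first term is determined by
`w` (if `i = 0`) or by its second term (if `0 < i`). -/
theorem eqOn_of_pathCode_eq {G : SimpleGraph V} {n : ℕ} {e : V → V → Fin n}
    (he : ∀ v a b, G.Adj v a → G.Adj v b → e v a = e v b → a = b) {w : V} {t i : ℕ}
    (hi : i ≤ t) {f g : ℕ → V}
    (hf : ∀ j < t, G.Adj (f j) (f (j + 1))) (hg : ∀ j < t, G.Adj (g j) (g (j + 1)))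
    (hfw : G.Adj w (f i)) (hgw : G.Adj w (g i))
    (hzero : i = 0 → f 0 = g 0) (hone : f 1 = g 1 → f 0 = g 0)
    (hcode : pathCode e w t i f = pathCode e w t i g) : ∀ j ≤ t, f j = g j := by
  have hc : ∀ j (hj : j < t), pathCode e w t i f ⟨j, hj⟩ = pathCode e w t i g ⟨j, hj⟩ :=
    fun j hj => congrFun hcode _
  have hfi : f i = g i := by
    rcases Nat.eq_zero_or_pos i with h0 | h0
    · rw [h0]; exact hzero h0
    · have := hc 0 (by omega)
      simp only [pathCode, h0, if_true] at this
      exact he w _ _ hfw hgw this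
  have hpos : ∀ j, 1 ≤ j → j ≤ i → f j = g j := by
    intro j hj1 hji
    refine Nat.decreasingInduction' (P := fun j => f j = g j) ?_ hji hfi
    intro k hki hjk ih
    have := hc k (by omega)
    simp only [pathCode, hki, if_true, show k ≠ 0 by omega, if_false] at this
    have hfk := (hf k (by omega)).symm
    have hgk := (hg k (by omega)).symm
    rw [ih] at this hfk
    exact he _ _ _ hfk hgk this
  have hge : ∀ j, i ≤ j → j ≤ t → f j = g j := by
    intro j hij
    induction j, hij using Nat.le_induction with
    | base => exact fun _ => hfi
    | succ k hik ih =>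
      intro hk
      have ih := ih (by omega)
      have := hc k (by omega)
      simp only [pathCode, show ¬ k < i by omega, if_false] at this
      have hfk := hf k (by omega)
      rw [ih] at this hfk
      exact he _ _ _ hfk (hg k (by omega)) this
  intro j hj
  rcases Nat.lt_or_ge j i with hji | hij
  · rcases Nat.eq_zero_or_pos j with rfl | h0
    · exact hone (hpos 1 le_rfl (by omega))
    · exact hpos j h0 hji.le
  · exact hge j hij hj

/-- Walks of the same length through the same vertices are equal, endpoints included. -/
theorem sigma_walk_ext {G : SimpleGraph V} {t : ℕ} {p q : Σ u : V, Σ v : V, G.Walk u v}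
    (hp : p.2.2.length = t) (hq : q.2.2.length = t)
    (h : ∀ j ≤ t, p.2.2.getVert j = q.2.2.getVert j) : p = q := by
  obtain ⟨u, v, p⟩ := p
  obtain ⟨u', v', q⟩ := q
  dsimp only at hp hq h
  obtain rfl : u = u' := by simpa using h 0 (Nat.zero_le _)
  obtain rfl : v = v' := by
    have := h t le_rfl
    rwa [p.getVert_of_length_le hp.le, q.getVert_of_length_le hq.le] at this
  obtain rfl : p = q := Walk.ext_getVert_le_length (hp.trans hq.symm) fun j hj => h j (hp ▸ hj)
  rfl

/-- If `w ∉ U`, then at most `(t+2)(d+1)^t` escaping paths contain a vertex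
of the closed neighborhood of `w`. -/
theorem stmt4 {V : Type*} [Fintype V] (t d : ℕ) (ht : 0 < t) (hd : 0 < d)
    (G : SimpleGraph V) [DecidableRel G.Adj]
    (hreg : G.IsRegularOfDegree (d + 1)) (hgirth : (2 * t + 2 : ℕ∞) < G.girth)
    (r : V) (S : Set V) (hS : ∀ s ∈ S, G.dist r s = t)
    (U : Set V) (hU : U = pathUnion G t r S)
    (w : V) (hw : w ∉ U) :
    {p : Σ u : V, Σ v : V, G.Walk u v |
        IsEscapingPath G t S U p ∧ ∃ x ∈ p.2.2.support, x = w ∨ G.Adj w x}.ncard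
      ≤ (t + 2) * (d + 1) ^ t := by
  subst hU
  have hgirth' : 2 * t + 2 < G.girth := by exact_mod_cast hgirth
  have hSU : ∀ s ∈ S, s ∈ pathUnion G t r S := by
    intro s hs
    have hne : G.dist r s ≠ 0 := by rw [hS s hs]; omega
    obtain ⟨p, hp, hpl⟩ := (Reachable.of_dist_ne_zero hne).exists_path_of_dist
    exact ⟨s, hs, p, hp, hpl.trans (hS s hs), p.end_mem_support⟩
  obtain ⟨e, he⟩ := exists_neighbor_labelling d.succ_pos hreg
  set A := {p : Σ u : V, Σ v : V, G.Walk u v |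
    IsEscapingPath G t S (pathUnion G t r S) p ∧ ∃ x ∈ p.2.2.support, x = w ∨ G.Adj w x}
  have hidx : ∀ p : A, ∃ i : Fin (t + 1), G.Adj w (p.1.2.2.getVert i) := by
    rintro ⟨p, ⟨-, hpl, hpS, -⟩, hx⟩
    have hpw : p.1 ≠ w := fun h => hw (h ▸ hSU _ hpS)
    obtain ⟨i, hi, hadj⟩ := exists_adj_getVert hpw hx
    exact ⟨⟨i, by omega⟩, hadj⟩
  choose idx hidx using hidx
  let code : A → Fin (t + 1) × (Fin t → Fin (d + 1)) := fun p =>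
    (idx p, pathCode e w t (idx p) p.1.2.2.getVert)
  have hinj : Function.Injective code := by
    intro p q hpq
    obtain ⟨hi, hcode⟩ := Prod.mk.inj hpq
    have hpw := hidx p
    have hqw := hidx q
    rw [← hi] at hcode hqw
    obtain ⟨-, hpl, hpS, hp1⟩ := p.2.1
    obtain ⟨-, hql, hqS, hq1⟩ := q.2.1
    have hpadj : ∀ j < t, G.Adj (p.1.2.2.getVert j) (p.1.2.2.getVert (j + 1)) := fun j hj =>
      p.1.2.2.adj_getVert_succ (hpl ▸ hj)
    have hqadj : ∀ j < t, G.Adj (q.1.2.2.getVert j) (q.1.2.2.getVert (j + 1)) := fun j hj =>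
      q.1.2.2.adj_getVert_succ (hql ▸ hj)
    rw [← p.1.2.2.getVert_zero] at hpS
    rw [← q.1.2.2.getVert_zero] at hqS
    refine Subtype.ext (sigma_walk_ext hpl hql
      (eqOn_of_pathCode_eq he (Nat.lt_succ_iff.1 (idx p).2) hpadj hqadj hpw hqw ?_ ?_ hcode))
    · intro h0
      rw [h0] at hpw hqw
      exact eq_of_adj_of_notMem_pathUnion ht hgirth' hS hw hpS hqS hpw.symm hqw.symm
    · intro h1
      exact eq_of_adj_of_notMem_pathUnion ht hgirth' hS hp1 hpS hqS (hpadj 0 ht)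
        (h1 ▸ hqadj 0 ht)
  calc A.ncard = Nat.card A := (Nat.card_coe_set_eq A).symm
    _ ≤ Nat.card (Fin (t + 1) × (Fin t → Fin (d + 1))) := Nat.card_le_card_of_injective code hinj
    _ = (t + 1) * (d + 1) ^ t := by simp
    _ ≤ (t + 2) * (d + 1) ^ t := Nat.mul_le_mul_right _ (by omega)
end
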